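/- Let ν ∈ ℝ, h > 0, b ∈ ℝ and a < 1/2, and let f : (0,∞) → ℝ be continuous such that there exist a constant C > 0 and real exponents p₀, p₁ with |f(x)| ≤ C·x^{p₀} for 0 < x ≤ 1 and |f(x)| ≤ C·x^{p₁} for x ≥ 1. Then the function x ↦ f(1/x) · e^{ax} · x^{−b} · α_{ν,h}(x) is Lebesgue integrable on (0,∞). -/

import Mathlib

open MeasureTheory Real Set

/-- `ψ_ξ(h) = ∫_0^∞ exp (-w²/(2h) - ξ cosh w) sinh w sin (πw/h) dw`. -/
noncomputable def psi (h ξ : ℝ) : ℝ :=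
  ∫ w in Set.Ioi (0:ℝ),
    Real.exp (-w^2/(2*h) - ξ * Real.cosh w) * Real.sinh w * Real.sin (Real.pi * w / h)

/-- Yor's Asia density `α_{ν,h}(x) = e^{-x/2} ∫_0^∞ y^ν e^{-x y²/2} ψ_{xy}(h) dy`. -/
noncomputable def asiaDensity (ν h x : ℝ) : ℝ :=
  Real.exp (-x/2) * ∫ y in Set.Ioi (0:ℝ), y ^ ν * Real.exp (-x*y^2/2) * psi h (x*y)

lemma expRem_nonneg (N : ℕ) : ∀ t : ℝ, 0 ≤ t →
    0 ≤ (-1)^N * (Real.exp (-t) - ∑ k ∈ Finset.range N, (-t)^k / (k.factorial : ℝ)) := by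
  induction N with
  | zero => intro t _; simp; positivity
  | succ N ih =>
    have hd : ∀ t : ℝ, HasDerivAt (fun t : ℝ => (-1)^(N+1) * (Real.exp (-t) - ∑ k ∈ Finset.range (N+1), (-t)^k / (k.factorial : ℝ)))
        ((-1)^N * (Real.exp (-t) - ∑ k ∈ Finset.range N, (-t)^k / (k.factorial : ℝ))) t := by
      intro t
      have h1 : HasDerivAt (fun t : ℝ => Real.exp (-t)) (-Real.exp (-t)) t := by
        simpa using (hasDerivAt_neg t).exp
      have h2 : HasDerivAt (fun t : ℝ => ∑ k ∈ Finset.range (N+1), (-t)^k / (k.factorial : ℝ))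
          (∑ k ∈ Finset.range (N+1), ((k:ℝ) * (-t)^(k-1) * (-1)) / (k.factorial : ℝ)) t := by
        apply HasDerivAt.fun_sum
        intro k _
        exact ((hasDerivAt_neg t).pow k).div_const _
      have h3 : (∑ k ∈ Finset.range (N+1), ((k:ℝ) * (-t)^(k-1) * (-1)) / (k.factorial : ℝ))
          = - ∑ k ∈ Finset.range N, (-t)^k / (k.factorial : ℝ) := by
        rw [Finset.sum_range_succ', ← Finset.sum_neg_distrib]
        simp only [Nat.cast_zero, zero_mul, zero_div, add_zero]
        apply Finset.sum_congr rfl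
        intro k _
        have : (k.factorial : ℝ) ≠ 0 := by positivity
        have : (k:ℝ) + 1 ≠ 0 := by positivity
        rw [Nat.factorial_succ]
        push_cast
        field_simp
      rw [h3] at h2
      refine ((h1.fun_sub h2).const_mul ((-1)^(N+1))).congr_deriv ?_
      ring
    have hm : MonotoneOn (fun t : ℝ => (-1)^(N+1) * (Real.exp (-t) - ∑ k ∈ Finset.range (N+1), (-t)^k / (k.factorial : ℝ))) (Set.Ici 0) := by
      apply monotoneOn_of_deriv_nonneg (convex_Ici 0)
      · exact fun t _ => (hd t).continuousAt.continuousWithinAt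
      · exact fun t _ => (hd t).differentiableAt.differentiableWithinAt
      · intro t ht
        rw [(hd t).deriv]
        exact ih t (interior_subset ht)
    intro t ht
    have := hm (Set.mem_Ici.2 le_rfl) (Set.mem_Ici.2 ht) ht
    refine le_trans (le_of_eq ?_) this
    simp [Finset.sum_range_succ']

lemma expRem_abs_le (N : ℕ) (t : ℝ) (ht : 0 ≤ t) :
    |Real.exp (-t) - ∑ k ∈ Finset.range N, (-t)^k / (k.factorial : ℝ)| ≤ t^N := by
  have h0 := expRem_nonneg N t ht
  have h1 := expRem_nonneg (N+1) t ht
  rw [Finset.sum_range_succ] at h1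
  have e : |Real.exp (-t) - ∑ k ∈ Finset.range N, (-t)^k / (k.factorial : ℝ)| =
    (-1)^N * (Real.exp (-t) - ∑ k ∈ Finset.range N, (-t)^k / (k.factorial : ℝ)) := by
    rw [← abs_of_nonneg h0, abs_mul]; simp
  rw [e]
  have h2 : (-1:ℝ)^N * (-t)^N = t^N := by rw [← mul_pow]; simp
  have h3 : t^N / (N.factorial:ℝ) ≤ t^N := by
    apply div_le_self (by positivity)
    exact_mod_cast Nat.factorial_pos N
  have h4 : (-1:ℝ)^N * ((-t)^N / (N.factorial:ℝ)) = t^N / (N.factorial:ℝ) := by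
    rw [← h2]; ring
  rw [pow_succ] at h1
  nlinarith

lemma integrable_gauss_exp (h : ℝ) (hh : 0 < h) (m : ℝ) :
    Integrable (fun w : ℝ => Real.exp (-w^2/(2*h)) * Real.exp (m*w)) := by
  have h1 := (integrable_exp_neg_mul_sq (b := 1/(2*h)) (by positivity)).comp_sub_right (m*h)
  refine (h1.const_mul (Real.exp (m^2*h/2))).congr (Filter.Eventually.of_forall fun w => ?_)
  simp only
  rw [← Real.exp_add, ← Real.exp_add]
  congr 1
  field_simp
  ring

lemma integrable_gauss_cosh (h : ℝ) (hh : 0 < h) (k : ℕ) : ∀ (m : ℝ),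
    Integrable (fun w : ℝ => Real.exp (-w^2/(2*h)) * Real.cosh w ^ k * Real.exp (m*w)) := by
  induction k with
  | zero => intro m; simpa using integrable_gauss_exp h hh m
  | succ k ih =>
    intro m
    refine (((ih (m+1)).add (ih (m-1))).const_mul (1/2)).congr
      (Filter.Eventually.of_forall fun w => ?_)
    simp only [Pi.add_apply]
    rw [show (m+1)*w = m*w + w by ring, show (m-1)*w = m*w+(-w) by ring, Real.exp_add,
      Real.exp_add, pow_succ, Real.cosh_eq w]
    ring

lemma integrable_gauss_cosh_sin (h : ℝ) (hh : 0 < h) (k : ℕ) (m : ℝ) :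
    Integrable (fun w : ℝ => Real.exp (-w^2/(2*h)) * Real.cosh w ^ k * Real.exp (m*w)
      * Real.sin (Real.pi * w / h)) := by
  refine (integrable_gauss_cosh h hh k m).mul_bdd (c := 1) ?_ ?_
  · exact (Continuous.aestronglyMeasurable (by fun_prop))
  · exact Filter.Eventually.of_forall fun w => by simpa using Real.abs_sin_le_one _

lemma integral_gauss_exp_sin (h : ℝ) (hh : 0 < h) (m : ℤ) :
    ∫ w : ℝ, Real.exp (-w^2/(2*h)) * Real.exp (m*w) * Real.sin (Real.pi * w / h) = 0 := by
  have h1 := integral_sub_left_eq_self (fun w : ℝ => Real.exp (-w^2/(2*h)) * Real.exp (m*w) * Real.sin (Real.pi * w / h)) volume (2*m*h)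
  have h2 : ∀ w : ℝ, Real.exp (-(2*m*h-w)^2/(2*h)) * Real.exp (m*(2*m*h-w)) * Real.sin (Real.pi * (2*m*h-w) / h) = - (Real.exp (-w^2/(2*h)) * Real.exp (m*w) * Real.sin (Real.pi * w / h)) := by
    intro w
    have e1 : Real.pi * (2*m*h-w) / h = m * (2*Real.pi) - Real.pi * w / h := by
      field_simp
    rw [e1, Real.sin_int_mul_two_pi_sub, ← Real.exp_add, ← Real.exp_add]
    have e2 : -(2*m*h-w)^2/(2*h) + m*(2*m*h-w) = -w^2/(2*h) + m*w := by
      field_simp; ring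
    rw [e2]; ring
  simp only [h2, integral_neg] at h1
  linarith

lemma integral_gauss_cosh_sin (h : ℝ) (hh : 0 < h) (k : ℕ) : ∀ (m : ℤ),
    ∫ w : ℝ, Real.exp (-w^2/(2*h)) * Real.cosh w ^ k * Real.exp (m*w)
      * Real.sin (Real.pi * w / h) = 0 := by
  induction k with
  | zero => intro m; simpa using integral_gauss_exp_sin h hh m
  | succ k ih =>
    intro m
    have e := integral_add (integrable_gauss_cosh_sin h hh k ((m+1:ℤ):ℝ))
      (integrable_gauss_cosh_sin h hh k ((m-1:ℤ):ℝ))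
    rw [ih, ih, add_zero] at e
    have e2 : ∀ w : ℝ, Real.exp (-w^2/(2*h)) * Real.cosh w ^ (k+1) * Real.exp (m*w)
      * Real.sin (Real.pi * w / h) = (1/2) * (Real.exp (-w^2/(2*h)) * Real.cosh w ^ k * Real.exp (((m+1:ℤ):ℝ)*w)
      * Real.sin (Real.pi * w / h) + Real.exp (-w^2/(2*h)) * Real.cosh w ^ k * Real.exp (((m-1:ℤ):ℝ)*w)
      * Real.sin (Real.pi * w / h)) := by
      intro w
      push_cast
      rw [show ((m:ℝ)+1)*w = m*w + w by ring, show ((m:ℝ)-1)*w = m*w+(-w) by ring, Real.exp_add,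
        Real.exp_add, pow_succ, Real.cosh_eq w]
      ring
    simp only [e2]
    rw [integral_const_mul, e, mul_zero]

lemma sinh_term (h : ℝ) (hh : 0 < h) (k : ℕ) :
    Integrable (fun w : ℝ => Real.exp (-w^2/(2*h)) * Real.cosh w ^ k * Real.sinh w
      * Real.sin (Real.pi * w / h)) ∧
    ∫ w : ℝ, Real.exp (-w^2/(2*h)) * Real.cosh w ^ k * Real.sinh w
      * Real.sin (Real.pi * w / h) = 0 := by
  have i1 := integrable_gauss_cosh_sin h hh k ((1:ℤ):ℝ)
  have i2 := integrable_gauss_cosh_sin h hh k ((-1:ℤ):ℝ)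
  have e := integral_sub i1 i2
  rw [integral_gauss_cosh_sin h hh, integral_gauss_cosh_sin h hh, sub_zero] at e
  have e2 : (fun w : ℝ => Real.exp (-w^2/(2*h)) * Real.cosh w ^ k * Real.sinh w
      * Real.sin (Real.pi * w / h)) = fun w : ℝ => (1/2) * (Real.exp (-w^2/(2*h)) * Real.cosh w ^ k * Real.exp (((1:ℤ):ℝ)*w)
      * Real.sin (Real.pi * w / h) - Real.exp (-w^2/(2*h)) * Real.cosh w ^ k * Real.exp (((-1:ℤ):ℝ)*w)
      * Real.sin (Real.pi * w / h)) := by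
    funext w
    rw [Real.sinh_eq]
    push_cast
    simp only [one_mul, neg_mul]
    ring
  rw [e2]
  exact ⟨(i1.sub i2).const_mul _, by rw [integral_const_mul, e, mul_zero]⟩

lemma psi_abs_le (h : ℝ) (hh : 0 < h) (N : ℕ) :
    ∃ K : ℝ, 0 ≤ K ∧ ∀ ξ : ℝ, 0 < ξ → |psi h ξ| ≤ K * ξ ^ N := by
  have hI : Integrable (fun w : ℝ => Real.exp (-w^2/(2*h)) * Real.cosh w ^ (N+1)) := by
    simpa using integrable_gauss_cosh h hh (N+1) 0
  have hK : 0 ≤ ∫ w : ℝ, Real.exp (-w^2/(2*h)) * Real.cosh w ^ (N+1) := by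
    apply integral_nonneg
    intro w
    have := Real.cosh_pos w
    positivity
  have hsc : ∀ w : ℝ, |Real.sinh w| ≤ Real.cosh w := by
    intro w
    rw [abs_le, Real.sinh_eq, Real.cosh_eq]
    have := Real.exp_pos w
    have := Real.exp_pos (-w)
    constructor <;> linarith
  refine ⟨∫ w : ℝ, Real.exp (-w^2/(2*h)) * Real.cosh w ^ (N+1), hK, fun ξ hξ => ?_⟩
  -- the integrand over the whole line
  set F : ℝ → ℝ := fun w =>
    Real.exp (-w^2/(2*h) - ξ * Real.cosh w) * Real.sinh w * Real.sin (Real.pi * w / h) with hF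
  have hsym : ∫ w : ℝ, F w = 2 * psi h ξ := by
    have h1 := integral_comp_abs (f := F)
    have h2 : ∀ w, F |w| = F w := by
      intro w
      rcases abs_choice w with hw | hw <;> rw [hw]
      simp only [hF]
      rw [Real.cosh_neg, Real.sinh_neg, neg_sq,
        show Real.pi * -w / h = -(Real.pi * w / h) by ring, Real.sin_neg]
      ring
    simp only [h2] at h1
    exact h1
  have hsum : Integrable (fun w : ℝ => ∑ k ∈ Finset.range N, ((-ξ)^k / (k.factorial : ℝ)) *
      (Real.exp (-w^2/(2*h)) * Real.cosh w ^ k * Real.sinh w * Real.sin (Real.pi * w / h))) :=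
    integrable_finsetSum _ fun k _ => (sinh_term h hh k).1.const_mul _
  have hsum0 : ∫ w : ℝ, ∑ k ∈ Finset.range N, ((-ξ)^k / (k.factorial : ℝ)) *
      (Real.exp (-w^2/(2*h)) * Real.cosh w ^ k * Real.sinh w * Real.sin (Real.pi * w / h)) = 0 := by
    rw [integral_finsetSum _ fun k _ => (sinh_term h hh k).1.const_mul _]
    apply Finset.sum_eq_zero
    intro k _
    rw [integral_const_mul, (sinh_term h hh k).2, mul_zero]
  have hFi : Integrable F := by
    refine Integrable.mono (sinh_term h hh 0).1 (Continuous.aestronglyMeasurable (by fun_prop)) ?_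
    refine Filter.Eventually.of_forall fun w => ?_
    simp only [hF, pow_zero, mul_one, norm_mul, Real.norm_eq_abs, Real.abs_exp]
    gcongr
    have := mul_pos hξ (Real.cosh_pos w)
    linarith
  have hdiff := integral_sub hFi hsum
  rw [hsum0, sub_zero, hsym] at hdiff
  have hb : ‖∫ w : ℝ, (F w - ∑ k ∈ Finset.range N, ((-ξ)^k / (k.factorial : ℝ)) *
      (Real.exp (-w^2/(2*h)) * Real.cosh w ^ k * Real.sinh w * Real.sin (Real.pi * w / h)))‖
      ≤ ∫ w : ℝ, ξ^N * (Real.exp (-w^2/(2*h)) * Real.cosh w ^ (N+1)) := by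
    apply norm_integral_le_of_norm_le (hI.const_mul _)
    refine Filter.Eventually.of_forall fun w => ?_
    have e : F w - ∑ k ∈ Finset.range N, ((-ξ)^k / (k.factorial : ℝ)) *
      (Real.exp (-w^2/(2*h)) * Real.cosh w ^ k * Real.sinh w * Real.sin (Real.pi * w / h))
      = Real.exp (-w^2/(2*h)) * (Real.exp (-(ξ * Real.cosh w)) -
        ∑ k ∈ Finset.range N, (-(ξ * Real.cosh w))^k / (k.factorial : ℝ)) * Real.sinh w *
          Real.sin (Real.pi * w / h) := by
      simp only [hF]
      rw [sub_eq_add_neg (-w^2/(2*h)), Real.exp_add, mul_sub, sub_mul, sub_mul, Finset.mul_sum,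
        Finset.sum_mul, Finset.sum_mul]
      congr 1
      apply Finset.sum_congr rfl
      intro k _
      rw [← neg_mul, mul_pow]
      ring
    rw [e, norm_mul, norm_mul, norm_mul]
    simp only [Real.norm_eq_abs, Real.abs_exp]
    have hc := Real.cosh_pos w
    have h1 := expRem_abs_le N (ξ * Real.cosh w) (by positivity)
    calc _ ≤ Real.exp (-w^2/(2*h)) * (ξ * Real.cosh w)^N * Real.cosh w * 1 := by
          gcongr
          · exact hsc w
          · exact Real.abs_sin_le_one _
      _ = _ := by ring
  rw [hdiff, integral_const_mul, Real.norm_eq_abs, abs_mul, abs_two] at hb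
  have := abs_nonneg (psi h ξ)
  linarith

lemma asiaDensity_abs_le (ν h : ℝ) (hh : 0 < h) (N : ℕ) (hN : -1 < ν + N) :
    ∃ K : ℝ, 0 ≤ K ∧ ∀ x : ℝ, 0 < x →
      |asiaDensity ν h x| ≤ K * (Real.exp (-x/2) * x ^ (((N:ℝ) - ν - 1)/2)) := by
  obtain ⟨K, hK, hpsi⟩ := psi_abs_le h hh N
  have hG : 0 < Real.Gamma ((ν + N + 1)/2) := Real.Gamma_pos_of_pos (by linarith)
  refine ⟨K * ((1/2:ℝ) ^ (-(ν + N + 1)/2) * (1/2) * Real.Gamma ((ν + N + 1)/2)), by positivity,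
    fun x hx => ?_⟩
  have hi := (integrableOn_rpow_mul_exp_neg_mul_rpow (p := 2) (s := ν + N) (b := x/2) hN
    two_pos (by positivity)).const_mul (K * x^N)
  have hv := integral_rpow_mul_exp_neg_mul_rpow (p := 2) (q := ν + N) (b := x/2)
    two_pos hN (by positivity)
  have hb : ‖∫ y in Set.Ioi (0:ℝ), y ^ ν * Real.exp (-x*y^2/2) * psi h (x*y)‖ ≤
      ∫ y in Set.Ioi (0:ℝ), K * x^N * (y ^ (ν + N) * Real.exp (-(x/2) * y^(2:ℝ))) := by
    apply norm_integral_le_of_norm_le hi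
    refine (ae_restrict_iff' measurableSet_Ioi).2 (Filter.Eventually.of_forall fun y hy => ?_)
    have hy : 0 < y := hy
    have h1 := hpsi (x*y) (by positivity)
    rw [norm_mul, norm_mul, Real.norm_eq_abs, Real.norm_eq_abs, Real.norm_eq_abs, Real.abs_exp,
      abs_of_pos (Real.rpow_pos_of_pos hy ν), Real.rpow_add hy, Real.rpow_natCast, Real.rpow_two,
      show -(x/2)*y^2 = -x*y^2/2 by ring]
    calc _ ≤ y ^ ν * Real.exp (-x*y^2/2) * (K * (x*y)^N) := by gcongr
      _ = _ := by rw [mul_pow]; ring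
  rw [integral_const_mul, hv, Real.norm_eq_abs] at hb
  unfold asiaDensity
  rw [abs_mul, Real.abs_exp]
  refine (mul_le_mul_of_nonneg_left hb (Real.exp_pos _).le).trans (le_of_eq ?_)
  rw [show x/2 = x * (1/2) by ring, Real.mul_rpow hx.le (by norm_num),
    show ((N:ℝ) - ν - 1)/2 = (N:ℝ) + -(ν + N + 1)/2 by ring, Real.rpow_add hx, Real.rpow_natCast]
  ring_nf

lemma measurable_psi (h : ℝ) : Measurable (psi h) := by
  unfold psi
  apply StronglyMeasurable.measurable
  apply StronglyMeasurable.integral_prod_right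
  apply Measurable.stronglyMeasurable
  unfold Function.uncurry
  fun_prop

lemma measurable_asiaDensity (ν h : ℝ) : Measurable (asiaDensity ν h) := by
  unfold asiaDensity
  apply Measurable.mul (by fun_prop)
  apply StronglyMeasurable.measurable
  apply StronglyMeasurable.integral_prod_right
  apply Measurable.stronglyMeasurable
  unfold Function.uncurry
  have := measurable_psi h
  fun_prop

/-- For `a < 1/2` and `f` continuous on `(0,∞)` behaving like a power map near the origin and
towards infinity, the map `x ↦ f(1/x) e^{ax} x^{-b} α_{ν,h}(x)` is integrable on `(0,∞)`. -/
theorem asiaDensity_weighted_power_integrable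
    (ν h b a : ℝ) (hh : 0 < h) (ha : a < 1/2)
    (f : ℝ → ℝ) (hf : ContinuousOn f (Set.Ioi 0))
    (C p₀ p₁ : ℝ) (hC : 0 < C)
    (hf0 : ∀ x : ℝ, 0 < x → x ≤ 1 → |f x| ≤ C * x ^ p₀)
    (hf1 : ∀ x : ℝ, 1 ≤ x → |f x| ≤ C * x ^ p₁) :
    IntegrableOn (fun x => f (1/x) * Real.exp (a*x) * x ^ (-b) * asiaDensity ν h x)
      (Set.Ioi 0) volume := by
  obtain ⟨N, hN⟩ := exists_nat_gt (max (-1 - ν) (max (ν + 1 + 2*(p₀ + b)) (ν + 1 + 2*(p₁ + b))))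
  have hN1 : -1 - ν < N := (le_max_left _ _).trans_lt hN
  have hN2 : ν + 1 + 2*(p₀ + b) < N :=
    ((le_max_left _ _).trans (le_max_right _ _)).trans_lt hN
  have hN3 : ν + 1 + 2*(p₁ + b) < N :=
    ((le_max_right _ _).trans (le_max_right _ _)).trans_lt hN
  obtain ⟨K, hK, hα⟩ := asiaDensity_abs_le ν h hh N (by linarith)
  set c : ℝ := ((N:ℝ) - ν - 1)/2 with hc
  have i0 := integrableOn_rpow_mul_exp_neg_mul_rpow (p := 1) (s := -p₀ - b + c) (b := 1/2 - a)
    (by rw [hc]; linarith) one_pos (by linarith)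
  have i1 := integrableOn_rpow_mul_exp_neg_mul_rpow (p := 1) (s := -p₁ - b + c) (b := 1/2 - a)
    (by rw [hc]; linarith) one_pos (by linarith)
  refine Integrable.mono' ((i0.add i1).const_mul (C * K)) ?_ ?_
  · refine AEStronglyMeasurable.mul ?_ (measurable_asiaDensity ν h).aestronglyMeasurable
    refine AEStronglyMeasurable.mul (AEStronglyMeasurable.mul ?_ ?_) ?_
    · apply ContinuousOn.aestronglyMeasurable _ measurableSet_Ioi
      apply hf.comp
      · exact continuousOn_const.div continuousOn_id fun x hx => (ne_of_gt hx)
      · intro x hx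
        have hx : 0 < x := hx
        have : 0 < 1/x := by positivity
        exact this
    · exact Measurable.aestronglyMeasurable (by fun_prop)
    · exact Measurable.aestronglyMeasurable (by fun_prop)
  · refine (ae_restrict_iff' measurableSet_Ioi).2 (Filter.Eventually.of_forall fun x hx => ?_)
    have hx : 0 < x := hx
    have hfx : |f (1/x)| ≤ C * (x ^ (-p₀) + x ^ (-p₁)) := by
      have q0 := Real.rpow_pos_of_pos hx (-p₀)
      have q1 := Real.rpow_pos_of_pos hx (-p₁)
      have e : ∀ p : ℝ, (1/x)^p = x^(-p) := fun p => by
        rw [one_div, Real.inv_rpow hx.le, Real.rpow_neg hx.le]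
      rcases le_total x 1 with h1 | h1
      · have := hf1 (1/x) ((one_le_div hx).2 h1)
        rw [e] at this
        nlinarith [mul_pos hC q0]
      · have := hf0 (1/x) (by positivity) ((div_le_one hx).2 h1)
        rw [e] at this
        nlinarith [mul_pos hC q1]
    rw [norm_mul, norm_mul, norm_mul, Real.norm_eq_abs, Real.norm_eq_abs, Real.norm_eq_abs,
      Real.norm_eq_abs, Real.abs_exp, abs_of_pos (Real.rpow_pos_of_pos hx (-b))]
    calc _ ≤ (C * (x ^ (-p₀) + x ^ (-p₁))) * Real.exp (a*x) * x ^ (-b) *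
          (K * (Real.exp (-x/2) * x ^ c)) := by
          have := hα x hx
          gcongr
      _ = _ := by
          simp only [Pi.add_apply]
          rw [Real.rpow_one, show -(1/2 - a) * x = a*x + -x/2 by ring, Real.exp_add,
            Real.rpow_add hx, Real.rpow_add hx, sub_eq_add_neg, sub_eq_add_neg, Real.rpow_add hx,
            Real.rpow_add hx]
          ring
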